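/- arXiv:1104.2722 — 5 statements merged into one kernel-verified Lean document; each statement's English description precedes it below -/
import Mathlib

section
/- For every U ∈ V, every f ∈ V and every α ∈ Fin n, one has D( Σ_s ∂_{α,s}(U)·D^s(f) ) = Σ_s ∂_{α,s}(D(U))·D^s(f); equivalently, as operators on V, D ∘ (Σ_s ∂_{α,s}(U)·D^s) = Σ_s ∂_{α,s}(D(U))·D^s. (Lemma 1 of the paper.) -/
open MvPolynomial

noncomputable section

/-- The algebra of differential polynomials in `n` dependent variables:
variable `(γ, k)` is the `k`-th `x`-derivative of the `γ`-th dependent variable. -/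
abbrev V (n : ℕ) : Type := MvPolynomial (Fin n × ℕ) ℚ

/-- The total `x`-derivative: the unique `ℚ`-linear derivation with `D (v (γ,k)) = v (γ,k+1)`. -/
def D (n : ℕ) : V n → V n :=
  ⇑(MvPolynomial.mkDerivation ℚ (fun p : Fin n × ℕ => (X (p.1, p.2 + 1) : V n)))

theorem aux_fin (n : ℕ) (U : V n) (α : Fin n) (g : ℕ → V n) :
    (Function.support fun s : ℕ => pderiv (α, s) U * g s).Finite := by
  have h : ((fun s : ℕ => (α, s)) ⁻¹' (U.vars : Set (Fin n × ℕ))).Finite :=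
    Set.Finite.preimage (fun a _ b _ hab => (Prod.mk.inj hab).2) U.vars.finite_toSet
  refine h.subset fun s hs => ?_
  by_contra hc
  apply hs
  have : pderiv (α, s) U = 0 := pderiv_eq_zero_of_notMem_vars (by simpa using hc)
  simp [this]

theorem aux_sum (n : ℕ) (U : V n) (α : Fin n) (g : ℕ → V n) :
    ∑ᶠ s : ℕ, pderiv (α, s) U * g s =
      mkDerivation ℚ (fun p : Fin n × ℕ => if p.1 = α then g p.2 else 0) U := by
  induction U using MvPolynomial.induction_on with
  | C a => simp
  | add p q hp hq =>
    rw [map_add, ← hp, ← hq, ← finsum_add_distrib (aux_fin n p α g) (aux_fin n q α g)]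
    simp only [map_add, add_mul]
  | mul_X p i hp =>
    rw [Derivation.leibniz, ← hp, mkDerivation_X]
    have e : ∀ s : ℕ, pderiv (α, s) (p * X i) * g s =
        p * (pderiv (α, s) (X i) * g s) + X i * (pderiv (α, s) p * g s) := by
      intro s
      rw [Derivation.leibniz, smul_eq_mul, smul_eq_mul]
      ring
    simp only [e]
    rw [finsum_add_distrib, ← mul_finsum' _ _ (aux_fin n (X i) α g), ← mul_finsum' _ _ (aux_fin n p α g)]
    · rw [smul_eq_mul, smul_eq_mul]
      congr 2
      obtain ⟨c, k⟩ := i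
      rw [finsum_eq_single _ k]
      · by_cases h : c = α
        · subst h; simp
        · have : ((c, k) : Fin n × ℕ) ≠ (α, k) := by simp [h]
          simp [pderiv_X_of_ne this, h]
      · intro s hs
        have : ((c, k) : Fin n × ℕ) ≠ (α, s) := by
          intro h; exact hs (Prod.mk.inj h).2.symm
        simp [pderiv_X_of_ne this]
    · exact (aux_fin n (X i) α g).subset fun s hs h => hs (by simp only at h ⊢; rw [h, mul_zero])
    · exact (aux_fin n p α g).subset fun s hs h => hs (by simp only at h ⊢; rw [h, mul_zero])

/-- Lemma 1 of the paper:
`D (Σ_s ∂_{α,s}(U) · D^s f) = Σ_s ∂_{α,s}(D U) · D^s f`. -/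
theorem stmt0 (n : ℕ) (hn : 1 ≤ n) (U f : V n) (α : Fin n) :
    D n (∑ᶠ s : ℕ, pderiv (α, s) U * (D n)^[s] f)
      = ∑ᶠ s : ℕ, pderiv (α, s) (D n U) * (D n)^[s] f := by
  rw [aux_sum, aux_sum n (D n U)]
  have key : ⁅mkDerivation ℚ (fun p : Fin n × ℕ => (X (p.1, p.2 + 1) : V n)),
      mkDerivation ℚ (fun p : Fin n × ℕ => if p.1 = α then (D n)^[p.2] f else 0)⁆ = 0 := by
    apply MvPolynomial.derivation_ext
    intro i
    rw [Derivation.commutator_apply, mkDerivation_X, mkDerivation_X, mkDerivation_X]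
    by_cases h : i.1 = α
    · simp only [h, if_true, Function.iterate_succ_apply']
      exact sub_self _
    · simp [h]
  have := congrArg (fun d => d U) key
  simp only [Derivation.commutator_apply, Derivation.zero_apply] at this
  exact sub_eq_zero.mp this

end
end

section
/- For every U ∈ V, every f ∈ V and every α ∈ Fin n, one has Σ_s (−1)^s D^s( ∂_{α,s}(D(U))·f ) = − Σ_s (−1)^s D^s( ∂_{α,s}(U)·D(f) ). (The formal adjoint of the equality of Lemma 1 of the paper, used to derive the chain rule for variational derivatives under a weak quasi-Miura transformation.) -/
open MvPolynomial

noncomputable section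

lemma D_add' (n : ℕ) (a b : V n) : D n (a + b) = D n a + D n b := by
  simp [D]

lemma D_mul' (n : ℕ) (a b : V n) : D n (a * b) = D n a * b + a * D n b := by
  simp [D, Derivation.leibniz]; ring

lemma D_iter_add (n s : ℕ) (a b : V n) : (D n)^[s] (a + b) = (D n)^[s] a + (D n)^[s] b := by
  induction s generalizing a b with
  | zero => rfl
  | succ k ih => simp only [Function.iterate_succ_apply, D_add', ih]

lemma D_iter_zero (n s : ℕ) : (D n)^[s] 0 = 0 := by
  have h := D_iter_add n s 0 0
  simpa using h

lemma D_X (n : ℕ) (p : Fin n × ℕ) : D n (X p) = X (p.1, p.2 + 1) := by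
  simp [D, mkDerivation_X]

lemma D_C (n : ℕ) (r : ℚ) : D n (C r) = 0 := by
  simp [D]

lemma D_pi (n : ℕ) (p q : Fin n × ℕ) : D n (Pi.single (M := fun _ => V n) p 1 q) = 0 := by
  by_cases h : q = p
  · subst h
    simpa using D_C n 1
  · simpa [h] using D_C n 0

lemma pderiv_D_zero (n : ℕ) (α : Fin n) (U : V n) :
    pderiv (α, 0) (D n U) = D n (pderiv (α, 0) U) := by
  induction U using MvPolynomial.induction_on with
  | C a => simp only [D_C, pderiv_C, map_zero]; simpa using (D_C n 0).symm
  | add p q hp hq => simp only [D_add', map_add, hp, hq]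
  | mul_X p q hp =>
    simp only [D_mul', D_X, D_add', map_add, pderiv_mul, hp, pderiv_X, D_pi]
    have : Pi.single (M := fun _ => V n) (α, 0) 1 (q.1, q.2 + 1) = 0 := by
      simp [Pi.single_apply]
    rw [this]; ring

lemma pderiv_D_succ (n : ℕ) (α : Fin n) (s : ℕ) (U : V n) :
    pderiv (α, s + 1) (D n U) = D n (pderiv (α, s + 1) U) + pderiv (α, s) U := by
  induction U using MvPolynomial.induction_on with
  | C a => simp only [D_C, pderiv_C, map_zero]; simpa using (D_C n 0).symm
  | add p q hp hq => simp only [D_add', map_add, hp, hq]; ring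
  | mul_X p q hp =>
    simp only [D_mul', D_X, D_add', map_add, pderiv_mul, hp, pderiv_X, D_pi]
    have : Pi.single (M := fun _ => V n) (α, s + 1) 1 (q.1, q.2 + 1)
        = Pi.single (M := fun _ => V n) (α, s) 1 q := by
      simp [Pi.single_apply, Prod.ext_iff]
    rw [this]; ring

lemma partial_sum (n : ℕ) (U f : V n) (α : Fin n) (N : ℕ) :
    ∑ s ∈ Finset.range (N + 1), (-1 : V n) ^ s * (D n)^[s] (pderiv (α, s) (D n U) * f)
      = (-1 : V n) ^ N * (D n)^[N + 1] (pderiv (α, N) U * f)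
        - ∑ s ∈ Finset.range (N + 1), (-1 : V n) ^ s * (D n)^[s] (pderiv (α, s) U * D n f) := by
  induction N with
  | zero => simp [pderiv_D_zero, D_mul']
  | succ N ih =>
    rw [Finset.sum_range_succ, ih, Finset.sum_range_succ _ (N + 1), pderiv_D_succ, add_mul,
      D_iter_add, Function.iterate_succ_apply (D n) (N + 1), D_mul', D_iter_add]
    ring

lemma exists_bound (n : ℕ) (U : V n) (α : Fin n) : ∃ N, ∀ s, N ≤ s → pderiv (α, s) U = 0 := by
  refine ⟨U.vars.sup Prod.snd + 1, fun s hs => pderiv_eq_zero_of_notMem_vars fun h => ?_⟩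
  have := Finset.le_sup (f := Prod.snd) h
  simp only at this
  omega

lemma finsum_range (n : ℕ) (W g : V n) (α : Fin n) (N : ℕ)
    (h : ∀ s, N ≤ s → pderiv (α, s) W = 0) :
    ∑ᶠ s : ℕ, (-1 : V n) ^ s * (D n)^[s] (pderiv (α, s) W * g)
      = ∑ s ∈ Finset.range N, (-1 : V n) ^ s * (D n)^[s] (pderiv (α, s) W * g) := by
  apply finsum_eq_sum_of_support_subset
  intro s hs
  by_contra hc
  apply hs
  have : N ≤ s := by simpa using hc
  simp [h s this, D_iter_zero]

/-- The formal adjoint of the equality of Lemma 1 of the paper: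
`Σ_s (−1)^s D^s(∂_{α,s}(D U) · f) = − Σ_s (−1)^s D^s(∂_{α,s}(U) · D f)`. -/
theorem stmt2 (n : ℕ) (hn : 1 ≤ n) (U f : V n) (α : Fin n) :
    ∑ᶠ s : ℕ, (-1 : V n) ^ s * (D n)^[s] (pderiv (α, s) (D n U) * f)
      = - ∑ᶠ s : ℕ, (-1 : V n) ^ s * (D n)^[s] (pderiv (α, s) U * D n f) := by
  obtain ⟨N, hN⟩ := exists_bound n U α
  obtain ⟨M, hM⟩ := exists_bound n (D n U) α
  rw [finsum_range n (D n U) f α (N + M + 1) (fun s hs => hM s (by omega)),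
    finsum_range n U (D n f) α (N + M + 1) (fun s hs => hN s (by omega)),
    partial_sum, hN (N + M) (by omega), zero_mul, D_iter_zero, mul_zero, zero_sub]

end
end

section
/- Assume Ψ : W → V is bijective. Fix constants c : Fin n → ℚ and set C_δ := c_δ·1 − Σ_ν c_ν·∂_{ν,0}(G_δ) ∈ V. Then for every P ∈ V: −Σ_ν c_ν·∂_{ν,0}(P) − Σ_{δ,m} D^m(C_δ)·Ψ(∂^W_{δ,m}(Ψ⁻¹(P))) = −Σ_δ c_δ·Ψ(∂^W_{δ,0}(Ψ⁻¹(P))). (Theorem 2 of the paper, the s-deformation formula for the weak quasi-Miura transformation: with the lower-triangular Givental deformation acting on v-jet expressions as −Σ_ν c_ν ∂/∂v_{ν,0} and satisfying s[v].w_δ = C_δ, the induced deformation of any quantity expressed in w-jets is −Σ_δ c_δ ∂/∂w_{δ,0}; taking P = ∂_{β,s}(G_α) gives the deformation of the operator L of the quasi-Miura transformation.) -/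
open MvPolynomial Function

noncomputable section

/-- A second copy of the algebra of differential polynomials (`w`-coordinates).
Its total derivative `D_W` and partial derivatives `∂^W_{β,m}` are given by the same
`D` and `pderiv` as for `V`. -/
abbrev W (n : ℕ) : Type := MvPolynomial (Fin n × ℕ) ℚ

/-- The jet prolongation `Ψ : W →ₐ V` of a weak quasi-Miura transformation `G`,
determined by `Ψ (w (β,m)) = D^m (G β)`. -/
def Psi (n : ℕ) (G : Fin n → V n) : W n →ₐ[ℚ] V n :=
  MvPolynomial.aeval (fun p : Fin n × ℕ => (D n)^[p.2] (G p.1))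

/-- The linearization operator `L^α_β (f) = Σ_s ∂_{β,s}(G α) · D^s f`. -/
def L (n : ℕ) (G : Fin n → V n) (α β : Fin n) (f : V n) : V n :=
  ∑ᶠ s : ℕ, pderiv (β, s) (G α) * (D n)^[s] f

/-- The formal adjoint `(L*)^α_β (f) = Σ_s (−1)^s D^s (∂_{β,s}(G α) · f)`. -/
def Lstar (n : ℕ) (G : Fin n → V n) (α β : Fin n) (f : V n) : V n :=
  ∑ᶠ s : ℕ, (-1 : V n) ^ s * (D n)^[s] (pderiv (β, s) (G α) * f)

/-- The evolutionary derivation associated to a family `a : Fin n → V n`: the unique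
`ℚ`-linear derivation with `E_a (v (γ,k)) = D^k (a γ)`. -/
def Ederiv (n : ℕ) (a : Fin n → V n) : V n → V n :=
  ⇑(MvPolynomial.mkDerivation ℚ (fun p : Fin n × ℕ => (D n)^[p.2] (a p.1)))

/-- The variational derivative `δ_α f = Σ_s (−1)^s D^s (∂_{α,s} f)` (on `V` or on `W`). -/
def vder (n : ℕ) (α : Fin n) (f : V n) : V n :=
  ∑ᶠ s : ℕ, (-1 : V n) ^ s * (D n)^[s] (pderiv (α, s) f)

theorem aux_finsum {σ : Type} (Φ : MvPolynomial σ ℚ →ₐ[ℚ] MvPolynomial σ ℚ)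
    (f : σ → MvPolynomial σ ℚ) (δ : MvPolynomial σ ℚ → MvPolynomial σ ℚ)
    (hadd : ∀ a b, δ (a + b) = δ a + δ b) (hc : ∀ a, δ (MvPolynomial.C a) = 0)
    (hX : ∀ p, δ (X p) = f p) (hmul : ∀ a b, δ (a * b) = Φ a * δ b + Φ b * δ a)
    (Q : MvPolynomial σ ℚ) : ∑ᶠ p, f p * Φ (pderiv p Q) = δ Q := by
  classical
  have hfin : ∀ Q : MvPolynomial σ ℚ, (Function.support fun p => f p * Φ (pderiv p Q)).Finite := by
    intro Q
    refine Q.vars.finite_toSet.subset ?_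
    intro p hp
    by_contra h
    apply hp
    have : pderiv p Q = 0 := pderiv_eq_zero_of_notMem_vars (by simpa using h)
    simp [this]
  induction Q using MvPolynomial.induction_on with
  | C a => simp [hc]
  | add a b ha hb =>
    rw [hadd, ← ha, ← hb, ← finsum_add_distrib (hfin a) (hfin b)]
    simp [mul_add]
  | mul_X a q ha =>
    rw [hmul, hX, ← ha, mul_finsum]
    have h1 : Φ a * f q = ∑ᶠ p, f p * Φ (a * pderiv p (X q)) := by
      rw [finsum_eq_single _ q]
      · simp [mul_comm]
      · intro p hp
        simp [pderiv_X_of_ne hp.symm]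
    rw [h1, ← finsum_add_distrib]
    · congr 1
      funext p
      simp only [Derivation.leibniz, smul_eq_mul, map_add, map_mul]
      ring
    · refine (Set.finite_singleton q).subset ?_
      intro p hp
      by_contra h
      apply hp
      have h : p ≠ q := h
      simp [pderiv_X_of_ne h.symm]
    · refine (hfin a).subset ?_
      intro p hp h
      apply hp
      simp only at h
      simp [h]

theorem aux_comm (n : ℕ) (ν : Fin n) (f : V n) :
    pderiv (ν, 0) (D n f) = D n (pderiv (ν, 0) f) := by
  classical
  have h : ⁅(pderiv (ν, 0) : Derivation ℚ (V n) (V n)),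
      MvPolynomial.mkDerivation ℚ (fun p : Fin n × ℕ => (X (p.1, p.2 + 1) : V n))⁆ = 0 := by
    apply MvPolynomial.derivation_ext
    intro p
    rw [Derivation.commutator_apply, mkDerivation_X, pderiv_X_of_ne (by simp), pderiv_X]
    by_cases hp : (ν, 0) = p
    · subst hp; simp
    · simp [Pi.single_apply, hp, Ne.symm hp]
  have h2 := congrArg (fun d => d f) h
  simp only [Derivation.commutator_apply, Derivation.zero_apply] at h2
  exact sub_eq_zero.mp h2

theorem aux_D_iter (n : ℕ) (c : Fin n → ℚ) (a : ℚ) (g : V n) (m : ℕ) :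
    (D n)^[m] (a • (1 : V n) - ∑ ν : Fin n, c ν • pderiv (ν, 0) g)
      = (if m = 0 then a • (1 : V n) else 0)
        - ∑ ν : Fin n, c ν • pderiv (ν, 0) ((D n)^[m] g) := by
  induction m with
  | zero => simp
  | succ m ih =>
    rw [Function.iterate_succ_apply', ih, Function.iterate_succ_apply']
    simp only [aux_comm]
    simp only [D, map_sub, map_sum, Derivation.map_smul]
    split_ifs <;> simp_all

/-- Theorem 2 of the paper: the s-deformation formula for the weak quasi-Miura transformation.
With `C δ = c δ • 1 − Σ_ν c ν • ∂_{ν,0}(G δ)` (the value of `s[v].w_δ`), the induced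
deformation of any quantity expressed in `w`-jets is `−Σ_δ c δ • ∂/∂w_{δ,0}`. -/
theorem stmt7 (n : ℕ) (hn : 1 ≤ n) (G : Fin n → V n)
    (hΨ : Function.Bijective (Psi n G)) (c : Fin n → ℚ)
    (Cfam : Fin n → V n)
    (hC : ∀ δ : Fin n, Cfam δ = c δ • (1 : V n) - ∑ᶠ ν : Fin n, c ν • pderiv (ν, 0) (G δ))
    (P : V n) :
    - (∑ᶠ ν : Fin n, c ν • pderiv (ν, 0) P)
      - ∑ᶠ p : Fin n × ℕ,
          (D n)^[p.2] (Cfam p.1)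
            * Psi n G (pderiv p (Function.invFun (Psi n G) P))
      = - ∑ᶠ δ : Fin n, c δ • Psi n G (pderiv (δ, 0) (Function.invFun (Psi n G) P)) := by
  obtain ⟨Q, rfl⟩ := hΨ.2 P
  rw [Function.leftInverse_invFun hΨ.1 Q]
  simp only [finsum_eq_sum_of_fintype] at hC ⊢
  rw [aux_finsum (Psi n G) (fun p => (D n)^[p.2] (Cfam p.1))
    (fun Q => ∑ δ, c δ • Psi n G (pderiv (δ, 0) Q) - ∑ ν, c ν • pderiv (ν, 0) (Psi n G Q))]
  · abel
  · intro a b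
    simp only [map_add, smul_add, Finset.sum_add_distrib]
    abel
  · intro a
    have : Psi n G (C a) = C a := by simp [Psi, algebraMap_eq]
    simp [this]
  · classical
    rintro ⟨β, m⟩
    have h : Psi n G (X (β, m)) = (D n)^[m] (G β) := by simp [Psi]
    simp only [h, hC, aux_D_iter]
    congr 1
    rw [Finset.sum_eq_single β]
    · by_cases hm : m = 0
      · subst hm; simp
      · rw [pderiv_X_of_ne (by simp [hm])]; simp [hm]
    · intro b _ hb
      rw [pderiv_X_of_ne (by simp [hb.symm])]; simp
    · simp
  · intro a b
    simp only [map_mul, Derivation.leibniz, smul_eq_mul, map_add, smul_add,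
      Finset.sum_add_distrib, mul_sub, Finset.mul_sum, mul_smul_comm]
    abel

end
end

section
/- Assume Ψ : W → V is bijective. Fix a family a : Fin n → V with associated evolutionary derivation E_a. Then for all α, β ∈ Fin n and all f ∈ V: Σ_{γ,m} Ψ(∂^W_{γ,m}(Ψ⁻¹(E_a(G_α))))·D^m(L^γ_β(f)) − Σ_γ L^α_γ( Σ_m ∂_{β,m}(a_γ)·D^m(f) ) − Σ_s E_a(∂_{β,s}(G_α))·D^s(f) = 0. (The vanishing ΔL^β_α = 0, i.e. Lemma 2 of the paper in the special case U = 1, which is the key ingredient in the proof that all extra terms in the deformation formula for the Poisson bracket cancel.) -/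
open MvPolynomial Function

noncomputable section

theorem aux_fin_s9 {σ A : Type*} [CommRing A] [Algebra ℚ A] (φ : MvPolynomial σ ℚ →ₐ[ℚ] A)
    (h : MvPolynomial σ ℚ) (c : σ → A) :
    (Function.support fun p => φ (pderiv p h) * c p).Finite := by
  classical
  refine (h.vars.finite_toSet).subset ?_
  intro p hp
  by_contra hn
  apply hp
  have : pderiv p h = 0 := pderiv_eq_zero_of_notMem_vars (by simpa using hn)
  simp [this]

theorem aux_chain {σ A : Type*} [CommRing A] [NoZeroDivisors A] [Algebra ℚ A] (φ : MvPolynomial σ ℚ →ₐ[ℚ] A)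
    (d : Derivation ℚ A A) (h : MvPolynomial σ ℚ) :
    d (φ h) = ∑ᶠ p, φ (pderiv p h) * d (φ (X p)) := by
  classical
  induction h using MvPolynomial.induction_on with
  | C r =>
    have : φ (C r) = algebraMap ℚ A r := by
      rw [← MvPolynomial.algebraMap_eq]; exact φ.commutes r
    rw [this]
    simp
  | add p q hp hq =>
    rw [map_add, map_add, hp, hq, ← finsum_add_distrib (aux_fin_s9 φ p _) (aux_fin_s9 φ q _)]
    simp only [map_add, add_mul]
  | mul_X p i hp =>
    rw [map_mul, Derivation.leibniz, hp, smul_eq_mul, smul_eq_mul,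
      mul_finsum]
    have h1 : φ p * d (φ (X i)) = ∑ᶠ j, φ p * φ (pderiv j (X i)) * d (φ (X j)) := by
      rw [finsum_eq_single _ i]
      · simp
      · intro j hj
        rw [pderiv_X_of_ne hj.symm]; simp
    rw [h1, ← finsum_add_distrib]
    · apply finsum_congr
      intro j
      rw [Derivation.leibniz, map_add, smul_eq_mul, smul_eq_mul, map_mul, map_mul]
      ring
    · refine (Set.finite_singleton i).subset ?_
      intro j hj
      by_contra hne
      apply hj
      have : pderiv j (X i : MvPolynomial σ ℚ) = 0 := pderiv_X_of_ne (fun h => hne h.symm)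
      simp [this]
    · refine (aux_fin_s9 φ p fun j => φ (X i) * d (φ (X j))).subset ?_
      intro j hj
      simp only [Function.mem_support] at hj ⊢
      intro h0; apply hj; rw [← h0]; ring

theorem aux_E (n : ℕ) (b : Fin n → V n) (g : V n) :
    Ederiv n b g = ∑ᶠ γ : Fin n, ∑ᶠ s : ℕ, pderiv (γ, s) g * (D n)^[s] (b γ) := by
  have h := aux_chain (AlgHom.id ℚ (V n))
    (MvPolynomial.mkDerivation ℚ (fun p : Fin n × ℕ => (D n)^[p.2] (b p.1))) g
  simp only [AlgHom.id_apply, mkDerivation_X] at h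
  unfold Ederiv
  rw [h, finsum_curry]
  exact aux_fin_s9 (AlgHom.id ℚ (V n)) g _

theorem aux_D0 (n : ℕ) (s : ℕ) : (D n)^[s] 0 = 0 := by
  apply Function.iterate_fixed
  unfold D; simp

theorem aux_Dsub (n : ℕ) (s : ℕ) (x y : V n) :
    (D n)^[s] (x - y) = (D n)^[s] x - (D n)^[s] y := by
  induction s generalizing x y with
  | zero => simp only [Function.iterate_zero, id_eq]
  | succ k ih =>
    simp only [Function.iterate_succ, Function.comp]
    rw [← ih]; congr 1; unfold D; simp

theorem aux_F (n : ℕ) (β : Fin n) (f g : V n) :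
    Ederiv n (Pi.single β f) g = ∑ᶠ s : ℕ, pderiv (β, s) g * (D n)^[s] f := by
  rw [aux_E, finsum_eq_single _ β]
  · simp
  · intro γ hγ
    simp [Pi.single_eq_of_ne hγ, aux_D0]

theorem aux_ED (n : ℕ) (b : Fin n → V n) (g : V n) :
    Ederiv n b (D n g) = D n (Ederiv n b g) := by
  have h : ⁅MvPolynomial.mkDerivation ℚ (fun p : Fin n × ℕ => (D n)^[p.2] (b p.1)),
      MvPolynomial.mkDerivation ℚ (fun p : Fin n × ℕ => (X (p.1, p.2 + 1) : V n))⁆ = 0 := by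
    apply MvPolynomial.derivation_ext
    intro p
    rw [Derivation.commutator_apply]
    simp only [mkDerivation_X, Function.iterate_succ', Function.comp]
    simp [D]
  have h2 := congrArg (fun d => d g) h
  simp only [Derivation.commutator_apply, Derivation.zero_apply] at h2
  exact sub_eq_zero.mp h2

theorem aux_EDs (n : ℕ) (b : Fin n → V n) (s : ℕ) (g : V n) :
    Ederiv n b ((D n)^[s] g) = (D n)^[s] (Ederiv n b g) := by
  induction s generalizing g with
  | zero => simp only [Function.iterate_zero, id_eq]
  | succ k ih =>
    rw [Function.iterate_succ_apply, Function.iterate_succ_apply, ih, aux_ED]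

theorem aux_comm_s9 (n : ℕ) (a b : Fin n → V n) (g : V n) :
    Ederiv n b (Ederiv n a g) - Ederiv n a (Ederiv n b g)
      = Ederiv n (fun γ => Ederiv n b (a γ)) g - Ederiv n (fun γ => Ederiv n a (b γ)) g := by
  have h : ⁅MvPolynomial.mkDerivation ℚ (fun p : Fin n × ℕ => (D n)^[p.2] (b p.1)),
      MvPolynomial.mkDerivation ℚ (fun p : Fin n × ℕ => (D n)^[p.2] (a p.1))⁆ =
      MvPolynomial.mkDerivation ℚ (fun p : Fin n × ℕ => (D n)^[p.2] (Ederiv n b (a p.1)))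
      - MvPolynomial.mkDerivation ℚ
          (fun p : Fin n × ℕ => (D n)^[p.2] (Ederiv n a (b p.1))) := by
    apply MvPolynomial.derivation_ext
    intro p
    rw [Derivation.commutator_apply, Derivation.sub_apply]
    simp only [mkDerivation_X]
    rw [← aux_EDs, ← aux_EDs]
    rfl
  have h2 := congrArg (fun d => d g) h
  simp only [Derivation.commutator_apply, Derivation.sub_apply] at h2
  exact h2

theorem aux_T (n : ℕ) (a : Fin n → V n) (β : Fin n) (f g : V n) :
    Ederiv n a (Ederiv n (Pi.single β f) g)
      = (∑ᶠ s : ℕ, Ederiv n a (pderiv (β, s) g) * (D n)^[s] f)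
        + Ederiv n (Pi.single β (Ederiv n a f)) g := by
  have inj : Function.Injective (fun s : ℕ => (β, s)) := fun s t h => by simpa using h
  have hz : {s : ℕ | pderiv (β, s) g ≠ 0}.Finite := by
    refine ((aux_fin_s9 (AlgHom.id ℚ (V n)) g (fun _ => 1)).preimage
      (inj.injOn (s := _))).subset ?_
    intro s hs
    simpa using hs
  have hE0 : Ederiv n a 0 = 0 := by unfold Ederiv; simp
  rw [aux_F, aux_F, ← finsum_add_distrib]
  · have : Ederiv n a (∑ᶠ s : ℕ, pderiv (β, s) g * (D n)^[s] f)
        = ∑ᶠ s : ℕ, Ederiv n a (pderiv (β, s) g * (D n)^[s] f) := by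
      unfold Ederiv
      refine map_finsum (MvPolynomial.mkDerivation ℚ
        (fun p : Fin n × ℕ => (D n)^[p.2] (a p.1))) (hz.subset ?_)
      intro s hs h0
      apply hs; simp [h0]
    rw [this]
    apply finsum_congr
    intro s
    rw [← aux_EDs]
    unfold Ederiv
    rw [Derivation.leibniz, smul_eq_mul, smul_eq_mul]
    ring
  · refine hz.subset ?_
    intro s hs h0
    apply hs; simp [h0, hE0]
  · refine hz.subset ?_
    intro s hs h0
    apply hs; simp [h0]

/-- The vanishing `ΔL^β_α = 0`: Lemma 2 of the paper in the special case `U = 1`, the key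
ingredient in the proof that all extra terms in the deformation formula for the Poisson
bracket cancel. -/
theorem stmt9 (n : ℕ) (hn : 1 ≤ n) (G : Fin n → V n)
    (hΨ : Function.Bijective (Psi n G)) (a : Fin n → V n)
    (α β : Fin n) (f : V n) :
    (∑ᶠ p : Fin n × ℕ,
        Psi n G (pderiv p (Function.invFun (Psi n G) (Ederiv n a (G α))))
          * (D n)^[p.2] (L n G p.1 β f))
      - (∑ᶠ γ : Fin n, L n G α γ (∑ᶠ m : ℕ, pderiv (β, m) (a γ) * (D n)^[m] f))
      - (∑ᶠ s : ℕ, Ederiv n a (pderiv (β, s) (G α)) * (D n)^[s] f)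
      = 0 := by
  have hL : ∀ γ, L n G γ β f = Ederiv n (Pi.single β f) (G γ) := fun γ => by
    rw [aux_F]; rfl
  have h1 : (∑ᶠ p : Fin n × ℕ,
        Psi n G (pderiv p (Function.invFun (Psi n G) (Ederiv n a (G α))))
          * (D n)^[p.2] (L n G p.1 β f))
      = Ederiv n (Pi.single β f) (Ederiv n a (G α)) := by
    have h := aux_chain (Psi n G) (MvPolynomial.mkDerivation ℚ
      (fun p : Fin n × ℕ => (D n)^[p.2] ((Pi.single β f : Fin n → V n) p.1)))
      (Function.invFun (Psi n G) (Ederiv n a (G α)))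
    rw [Function.rightInverse_invFun hΨ.2] at h
    refine Eq.trans ?_ h.symm
    apply finsum_congr
    intro p
    rw [hL, ← aux_EDs]
    simp only [Psi, aeval_X]
    rfl
  have h2 : (∑ᶠ γ : Fin n, L n G α γ (∑ᶠ m : ℕ, pderiv (β, m) (a γ) * (D n)^[m] f))
      = Ederiv n (fun γ => Ederiv n (Pi.single β f) (a γ)) (G α) := by
    rw [aux_E]
    simp only [aux_F, L]
  have h3 : (fun γ => Ederiv n a ((Pi.single β f : Fin n → V n) γ))
      = Pi.single β (Ederiv n a f) := by
    funext γ
    by_cases h : γ = β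
    · subst h; simp
    · simp [Pi.single_eq_of_ne h, Ederiv]
  have hc := aux_comm_s9 n a (Pi.single β f) (G α)
  rw [h3, aux_T] at hc
  rw [h1, h2]
  linear_combination hc

end
end

section
/- For every g ∈ W, every β ∈ Fin n and every f ∈ V, the operator (Fréchet-derivative) chain rule holds: Σ_s ∂_{β,s}(Ψ(g))·D^s(f) = Σ_{γ,m} Ψ(∂^W_{γ,m}(g)) · D^m( L^γ_β(f) ). That is, the linearization operator of a composition of jet transformations is the composition of the linearization operators. (The identity equating the first summand of the coefficient form (3.10) with the first summand of the operator form (3.6) of the deformation formula in the paper.) -/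
open MvPolynomial Function

noncomputable section

theorem aux_fin_s11 {n : ℕ} (h : V n) : {p : Fin n × ℕ | pderiv p h ≠ 0}.Finite := by
  refine (h.vars.finite_toSet).subset ?_
  intro p hp
  by_contra hc
  exact hp (pderiv_eq_zero_of_notMem_vars (by simpa using hc))

theorem aux_fin2 {n : ℕ} (φ : W n →ₐ[ℚ] V n) (c : Fin n × ℕ → V n) (h : W n) :
    (Function.support fun p : Fin n × ℕ => φ (pderiv p h) * c p).Finite := by
  refine (aux_fin_s11 h).subset ?_
  intro p hp hc
  apply hp
  simp only [hc, map_zero, zero_mul]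

theorem aux_chain_s11 {n : ℕ} (φ : W n →ₐ[ℚ] V n) (d : Derivation ℚ (V n) (V n)) (g : W n) :
    d (φ g) = ∑ᶠ p : Fin n × ℕ, φ (pderiv p g) * d (φ (X p)) := by
  induction g using MvPolynomial.induction_on with
  | C a =>
    have : φ (C a) = algebraMap ℚ (V n) a := φ.commutes a
    rw [this]
    simp
  | add p q hp hq =>
    rw [map_add, map_add, hp, hq, ← finsum_add_distrib (aux_fin2 φ _ p) (aux_fin2 φ _ q)]
    refine finsum_congr fun r => ?_
    rw [map_add, map_add, add_mul]
  | mul_X p i hp =>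
    have h1 : ∀ r, φ (pderiv r (p * X i)) * d (φ (X r))
        = φ (X i) * (φ (pderiv r p) * d (φ (X r)))
          + φ p * (φ (pderiv r (X i)) * d (φ (X r))) := by
      intro r
      rw [Derivation.leibniz, map_add, smul_eq_mul, smul_eq_mul, map_mul, map_mul]
      ring
    rw [finsum_congr h1, finsum_add_distrib, ← mul_finsum' _ _ (aux_fin2 φ _ p),
      ← mul_finsum' _ _ (aux_fin2 φ _ (X i)), ← hp, map_mul, Derivation.leibniz,
      finsum_eq_single _ i]
    · simp only [pderiv_X_self, map_one, one_mul, smul_eq_mul]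
      ring
    · intro r hr
      rw [pderiv_X_of_ne hr.symm, map_zero, zero_mul]
    · refine (aux_fin2 φ (fun r => d (φ (X r))) p).subset ?_
      intro r hr hc
      apply hr
      have hc' : φ (pderiv r p) * d (φ (X r)) = 0 := hc
      simp only [hc', mul_zero]
    · refine (aux_fin2 φ (fun r => d (φ (X r))) (X i)).subset ?_
      intro r hr hc
      apply hr
      have hc' : φ (pderiv r (X i)) * d (φ (X r)) = 0 := hc
      simp only [hc', mul_zero]

def auxE (n : ℕ) (β : Fin n) (f : V n) : Derivation ℚ (V n) (V n) :=
  MvPolynomial.mkDerivation ℚ (fun p : Fin n × ℕ => if p.1 = β then (D n)^[p.2] f else 0)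

def auxD (n : ℕ) : Derivation ℚ (V n) (V n) :=
  MvPolynomial.mkDerivation ℚ (fun p : Fin n × ℕ => (X (p.1, p.2 + 1) : V n))

theorem auxE_eq (n : ℕ) (β : Fin n) (f h : V n) :
    auxE n β f h = ∑ᶠ s : ℕ, pderiv (β, s) h * (D n)^[s] f := by
  have h0 := aux_chain_s11 (AlgHom.id ℚ (V n)) (auxE n β f) h
  simp only [AlgHom.id_apply] at h0
  rw [h0]
  have hinj : Function.Injective (fun s : ℕ => ((β, s) : Fin n × ℕ)) := by
    intro a b hab
    simpa using hab
  have h2 : ∀ s : ℕ, pderiv (β, s) h * (D n)^[s] f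
      = (fun p : Fin n × ℕ => pderiv p h * auxE n β f (X p)) (β, s) := by
    intro s
    simp [auxE, mkDerivation_X]
  rw [finsum_congr h2,
    ← finsum_mem_range (f := fun p : Fin n × ℕ => pderiv p h * auxE n β f (X p)) hinj]
  rw [← finsum_mem_univ]
  apply finsum_mem_inter_support_eq'
  intro p hp
  refine ⟨fun _ => ?_, fun _ => trivial⟩
  by_contra hc
  apply hp
  have : p.1 ≠ β := by
    rintro rfl
    exact hc ⟨p.2, rfl⟩
  simp [auxE, mkDerivation_X, this]

theorem auxE_comm (n : ℕ) (β : Fin n) (f h : V n) :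
    auxE n β f (D n h) = D n (auxE n β f h) := by
  have : ⁅auxE n β f, auxD n⁆ = 0 := by
    apply MvPolynomial.derivation_ext
    intro p
    rw [Derivation.commutator_apply]
    simp only [auxD, auxE, mkDerivation_X, Derivation.coe_zero, Pi.zero_apply]
    split_ifs
    · rw [Function.iterate_succ_apply']
      exact sub_self _
    · simp
  have h1 := congrArg (fun d : Derivation ℚ (V n) (V n) => d h) this
  simp only [Derivation.commutator_apply, Derivation.coe_zero, Pi.zero_apply] at h1
  exact sub_eq_zero.mp h1

theorem auxE_comm_iter (n : ℕ) (β : Fin n) (f h : V n) (m : ℕ) :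
    auxE n β f ((D n)^[m] h) = (D n)^[m] (auxE n β f h) := by
  induction m with
  | zero => rfl
  | succ m ih =>
    rw [Function.iterate_succ_apply', Function.iterate_succ_apply', auxE_comm, ih]

/-- The operator (Fréchet-derivative) chain rule: the linearization operator of a composition
of jet transformations is the composition of the linearization operators:
`Σ_s ∂_{β,s}(Ψ g) · D^s f = Σ_{γ,m} Ψ(∂^W_{γ,m} g) · D^m (L^γ_β f)`. -/
theorem stmt11 (n : ℕ) (hn : 1 ≤ n) (G : Fin n → V n) (g : W n) (β : Fin n) (f : V n) :
    ∑ᶠ s : ℕ, pderiv (β, s) (Psi n G g) * (D n)^[s] f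
      = ∑ᶠ p : Fin n × ℕ, Psi n G (pderiv p g) * (D n)^[p.2] (L n G p.1 β f) := by
  rw [← auxE_eq, aux_chain_s11]
  refine finsum_congr fun p => ?_
  have h : Psi n G (X p) = (D n)^[p.2] (G p.1) := by simp [Psi]
  rw [h, auxE_comm_iter, auxE_eq]
  rfl

end
end
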